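/- For ℓ ≥ 6, the S-module D(A(C_ℓ^C)) of the ℓ-antihole (equal to the braid arrangement A(K_ℓ) with all ℓ hyperplanes ker(x_s − x_{s+1}), s = 1,…,ℓ and indices mod ℓ, deleted) is generated by θ_0, θ_1, …, θ_{ℓ−3}, φ_1, φ_2, …, φ_ℓ. -/

import Mathlib

open MvPolynomial CategoryTheory

/-- The polynomial ring `S = ℚ[x_1, …, x_ℓ]` (variables indexed by `Fin ℓ`). -/
abbrev Spoly (ℓ : ℕ) : Type := MvPolynomial (Fin ℓ) ℚ

/-- The module `D(A(G))` of logarithmic derivations of the graphic arrangement of a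
graph `G` on the vertex set `{1, …, ℓ}`: all `θ ∈ Der_ℚ(S)` such that `(x_i - x_j)`
divides `θ(x_i) - θ(x_j)` for every edge `{i, j}` of `G`. -/
noncomputable def logDer (ℓ : ℕ) (G : SimpleGraph (Fin ℓ)) :
    Submodule (Spoly ℓ) (Derivation ℚ (Spoly ℓ) (Spoly ℓ)) where
  carrier := {θ | ∀ i j : Fin ℓ, G.Adj i j → (X i - X j) ∣ θ (X i) - θ (X j)}
  add_mem' := by
    intro a b ha hb i j h
    have : (a + b) (X i) - (a + b) (X j)
        = (a (X i) - a (X j)) + (b (X i) - b (X j)) := by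
      simp only [Derivation.add_apply]; ring
    rw [this]
    exact dvd_add (ha i j h) (hb i j h)
  zero_mem' := by intro i j h; simp
  smul_mem' := by
    intro c θ hθ i j h
    have : (c • θ) (X i) - (c • θ) (X j) = c * (θ (X i) - θ (X j)) := by
      simp only [Derivation.smul_apply, smul_eq_mul]; ring
    rw [this]
    exact (hθ i j h).mul_left c

/-- The derivation `θ_i = Σ_j x_j^i ∂/∂x_j`. -/
noncomputable def θder (ℓ : ℕ) (i : ℕ) : Derivation ℚ (Spoly ℓ) (Spoly ℓ) :=
  MvPolynomial.mkDerivation ℚ (fun j : Fin ℓ => X j ^ i)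

/-- The derivation `φ_i = (∏_{j ∉ {i-1, i, i+1}} (x_i - x_j)) ∂/∂x_i`,
indices read cyclically. -/
noncomputable def φder (ℓ : ℕ) [NeZero ℓ] (i : Fin ℓ) : Derivation ℚ (Spoly ℓ) (Spoly ℓ) :=
  MvPolynomial.mkDerivation ℚ (fun j : Fin ℓ =>
    if j = i then ∏ t ∈ Finset.univ \ {i - 1, i, i + 1}, (X i - X t) else 0)

lemma X_sub_X_ne_zero {σ R : Type*} [CommRing R] [Nontrivial R] {a b : σ} (h : a ≠ b) :
    (X a - X b : MvPolynomial σ R) ≠ 0 :=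
  sub_ne_zero.2 fun e => h (X_injective e)

section Collapse

variable {σ : Type*} [DecidableEq σ] {R : Type*} [CommRing R]

/-- The substitution sending every variable indexed by `s` to `X a`. -/
noncomputable def collapse (a : σ) (s : Finset σ) : MvPolynomial σ R →ₐ[R] MvPolynomial σ R :=
  aeval fun j => if j ∈ s then X a else X j

lemma collapse_X (a : σ) (s : Finset σ) (j : σ) :
    collapse a s (X j : MvPolynomial σ R) = if j ∈ s then X a else X j := by
  simp [collapse]

lemma collapse_X_self (a : σ) (s : Finset σ) :
    collapse a s (X a : MvPolynomial σ R) = X a := by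
  simp [collapse_X]

lemma sub_collapse_mem (a : σ) (s : Finset σ) (p : MvPolynomial σ R) :
    p - collapse a s p ∈
      Ideal.span ((fun j => (X a - X j : MvPolynomial σ R)) '' (s : Set σ)) := by
  set I := Ideal.span ((fun j => (X a - X j : MvPolynomial σ R)) '' (s : Set σ)) with hI
  have h : Ideal.Quotient.mkₐ R I = (Ideal.Quotient.mkₐ R I).comp (collapse a s) := by
    refine MvPolynomial.algHom_ext fun j => ?_
    rw [AlgHom.comp_apply, collapse_X]
    split_ifs with hj
    · refine (Ideal.Quotient.eq.2 ?_).symm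
      exact Ideal.subset_span ⟨j, hj, rfl⟩
    · rfl
  exact Ideal.Quotient.eq.1 (DFunLike.congr_fun h p)

lemma X_sub_X_dvd_iff (a b : σ) (p : MvPolynomial σ R) :
    X a - X b ∣ p ↔ collapse a {b} p = 0 := by
  constructor
  · rintro ⟨q, rfl⟩
    simp [collapse_X]
  · intro h
    have := sub_collapse_mem a {b} p
    rw [h, sub_zero] at this
    simpa [Ideal.mem_span_singleton] using this

lemma X_sub_X_dvd_sub_collapse (a b : σ) (p : MvPolynomial σ R) :
    X a - X b ∣ p - collapse a {b} p := by
  simpa [Ideal.mem_span_singleton] using sub_collapse_mem a {b} p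

lemma prime_X_sub_X [IsDomain R] {a b : σ} (h : a ≠ b) :
    Prime (X a - X b : MvPolynomial σ R) := by
  refine ⟨X_sub_X_ne_zero h, fun hu => ?_, fun p q hpq => ?_⟩
  · have := (X_sub_X_dvd_iff a b (1 : MvPolynomial σ R)).1 hu.dvd
    simp at this
  · rw [X_sub_X_dvd_iff, map_mul, mul_eq_zero] at hpq
    simpa only [X_sub_X_dvd_iff] using hpq

lemma prod_X_sub_X_dvd [IsDomain R] {a : σ} {T : Finset σ} (ha : a ∉ T)
    {p : MvPolynomial σ R} (h : ∀ j ∈ T, X a - X j ∣ p) : ∏ j ∈ T, (X a - X j) ∣ p := by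
  induction T using Finset.induction_on generalizing p with
  | empty => simp
  | insert b T hb ih =>
    rw [Finset.mem_insert, not_or] at ha
    obtain ⟨q, rfl⟩ := h b (Finset.mem_insert_self b T)
    rw [Finset.prod_insert hb]
    refine mul_dvd_mul_left _ (ih ha.2 fun j hj => ?_)
    have hja : a ≠ j := fun e => ha.2 (e ▸ hj)
    refine ((prime_X_sub_X hja).dvd_or_dvd (h j (Finset.mem_insert_of_mem hj))).resolve_left ?_
    intro hd
    rw [X_sub_X_dvd_iff, map_sub, collapse_X_self, collapse_X,
      if_neg (by rw [Finset.mem_singleton]; rintro rfl; exact hb hj)] at hd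
    exact X_sub_X_ne_zero ha.1 hd

lemma X_sub_X_dvd_prod_sub_prod {a b : σ} (T : Finset σ) :
    (X a - X b : MvPolynomial σ R) ∣ ∏ j ∈ T, (X a - X j) - ∏ j ∈ T, (X b - X j) := by
  rw [X_sub_X_dvd_iff]
  simp [map_prod, collapse_X]

/-- If `f a` and `f b` are both compatible with `f j` for all `j ∈ T`, then modulo `X a - X b`
the difference `f a - f b` is a multiple of `∏ j ∈ T, (X a - X j)`. -/
lemma exists_dvd_sub_mul_prod [IsDomain R] {a b : σ} {T : Finset σ} (ha : a ∉ T) (hb : b ∉ T)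
    {f : σ → MvPolynomial σ R} (hfa : ∀ j ∈ T, X a - X j ∣ f a - f j)
    (hfb : ∀ j ∈ T, X b - X j ∣ f b - f j) :
    ∃ q, X a - X b ∣ f a - f b - q * ∏ j ∈ T, (X a - X j) := by
  have key : ∏ j ∈ T, (X a - X j) ∣ collapse a {b} (f a - f b) := by
    refine prod_X_sub_X_dvd ha fun j hj => ?_
    have hjb : j ∉ ({b} : Finset σ) := by
      rw [Finset.mem_singleton]; rintro rfl; exact hb hj
    have h1 := map_dvd (collapse a {b}) (hfa j hj)
    have h2 := map_dvd (collapse a {b}) (hfb j hj)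
    rw [map_sub (collapse a {b}) (X _), collapse_X_self, collapse_X, if_neg hjb] at h1
    rw [map_sub (collapse a {b}) (X _), collapse_X, collapse_X, if_neg hjb,
      if_pos (Finset.mem_singleton_self b)] at h2
    have h3 := dvd_sub h1 h2
    rwa [← map_sub, sub_sub_sub_cancel_right] at h3
  obtain ⟨q, hq⟩ := key
  refine ⟨q, ?_⟩
  rw [mul_comm q, ← hq]
  exact X_sub_X_dvd_sub_collapse a b _

/-- Newton interpolation of a compatible family at the variables indexed by `s`. -/
lemma exists_interpolation [IsDomain R] {f : σ → MvPolynomial σ R} (s : Finset σ)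
    (h : ∀ i ∈ s, ∀ j ∈ s, i ≠ j → X i - X j ∣ f i - f j) :
    ∃ P : Polynomial (MvPolynomial σ R), P.degree < s.card ∧ ∀ i ∈ s, P.eval (X i) = f i := by
  induction s using Finset.induction_on with
  | empty => exact ⟨0, by simp⟩
  | insert b s hb ih =>
    obtain ⟨P, hd, hP⟩ := ih fun i hi j hj =>
      h i (Finset.mem_insert_of_mem hi) j (Finset.mem_insert_of_mem hj)
    have hdvd : ∏ j ∈ s, (X b - X j) ∣ f b - P.eval (X b) := by
      refine prod_X_sub_X_dvd hb fun j hj => ?_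
      have h1 := h b (Finset.mem_insert_self b s) j (Finset.mem_insert_of_mem hj)
        (by rintro rfl; exact hb hj)
      have h2 := Polynomial.sub_dvd_eval_sub (X b) (X j) P
      rw [hP j hj] at h2
      simpa using dvd_sub h1 h2
    obtain ⟨q, hq⟩ := hdvd
    refine ⟨P + Polynomial.C q * ∏ j ∈ s, (Polynomial.X - Polynomial.C (X j)), ?_, ?_⟩
    · rw [Finset.card_insert_of_notMem hb]
      refine (Polynomial.degree_add_le _ _).trans_lt (max_lt (hd.trans (by norm_cast; omega)) ?_)
      refine (Polynomial.degree_mul_le _ _).trans_lt ?_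
      rw [Polynomial.degree_prod]
      simp only [Polynomial.degree_X_sub_C, Finset.sum_const, nsmul_eq_mul, mul_one]
      refine (add_le_add_left Polynomial.degree_C_le _).trans_lt ?_
      rw [zero_add]
      norm_cast
      omega
    · intro i hi
      rw [Polynomial.eval_add, Polynomial.eval_mul, Polynomial.eval_C, Polynomial.eval_prod]
      simp only [Polynomial.eval_sub, Polynomial.eval_X, Polynomial.eval_C]
      rcases Finset.mem_insert.1 hi with rfl | hi
      · rw [mul_comm, ← hq]; ring
      · rw [Finset.prod_eq_zero hi (sub_self _), mul_zero, add_zero, hP i hi]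

end Collapse

/-- Adjacency in the `ℓ`-cycle, expressed through the underlying natural numbers. -/
def CycAdj {ℓ : ℕ} (i j : Fin ℓ) : Prop :=
  i.val + 1 = j.val ∨ j.val + 1 = i.val ∨ (i.val = 0 ∧ j.val + 1 = ℓ) ∨ (j.val = 0 ∧ i.val + 1 = ℓ)

lemma cycleGraph_adj_iff {ℓ : ℕ} (hℓ : 2 < ℓ) (i j : Fin ℓ) :
    (SimpleGraph.cycleGraph ℓ).Adj i j ↔ CycAdj i j := by
  have hi := i.isLt
  have hj := j.isLt
  have key : ∀ u v : Fin ℓ,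
      (u - v).val = if v.val ≤ u.val then u.val - v.val else ℓ + u.val - v.val := by
    intro u v
    split_ifs with h
    · exact Fin.sub_val_of_le h
    · exact Fin.coe_sub_iff_lt.2 (Fin.lt_def.2 (not_le.1 h))
  rw [SimpleGraph.cycleGraph_adj', key, key, CycAdj]
  split_ifs <;> omega

lemma mem_sdiff_neighbours_iff {ℓ : ℕ} [NeZero ℓ] (hℓ : 2 < ℓ) (b t : Fin ℓ) :
    t ∈ Finset.univ \ {b - 1, b, b + 1} ↔ t ≠ b ∧ ¬ CycAdj b t := by
  have hb := b.isLt
  have ht := t.isLt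
  have h1 : (1 : Fin ℓ).val = 1 := by
    rw [Fin.val_one', Nat.mod_eq_of_lt (by omega)]
  have hadd : (b + 1).val = if b.val + 1 = ℓ then 0 else b.val + 1 := by
    rw [Fin.val_add, h1]
    split_ifs with h
    · rw [h, Nat.mod_self]
    · exact Nat.mod_eq_of_lt (by omega)
  have hsub : (b - 1).val = if b.val = 0 then ℓ - 1 else b.val - 1 := by
    split_ifs with h
    · rw [Fin.coe_sub_iff_lt.2 (by rw [Fin.lt_def]; omega), h1]
      omega
    · rw [Fin.sub_val_of_le (by rw [Fin.le_def]; omega), h1]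
  simp only [Finset.mem_sdiff, Finset.mem_univ, true_and, Finset.mem_insert,
    Finset.mem_singleton, Fin.ext_iff, hadd, hsub, CycAdj, ne_eq]
  split_ifs <;> omega

lemma derivation_sum_apply {R A M ι : Type*} [CommSemiring R] [CommSemiring A]
    [AddCommMonoid M] [Algebra R A] [Module A M] [Module R M] (s : Finset ι)
    (D : ι → Derivation R A M) (x : A) : (∑ i ∈ s, D i) x = ∑ i ∈ s, D i x := by
  rw [← Derivation.coeFnAddMonoidHom_apply, map_sum, Finset.sum_apply]
  rfl

section Derivations

variable {ℓ : ℕ}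

lemma θder_X (k : ℕ) (j : Fin ℓ) : θder ℓ k (X j) = X j ^ k := by
  simp [θder]

/-- The non-edges of the complete graph with the path `k, k + 1, …, ℓ - 1, 0` deleted. -/
def IsDeleted (k : ℕ) (i j : Fin ℓ) : Prop :=
  (k ≤ i.val ∧ j.val = i.val + 1) ∨ (k ≤ j.val ∧ i.val = j.val + 1) ∨
    (i.val = 0 ∧ j.val + 1 = ℓ) ∨ (j.val = 0 ∧ i.val + 1 = ℓ)

/-- Membership in the derivation module of the complete graph with the path
`k, k + 1, …, ℓ - 1, 0` deleted. -/
def Compat (k : ℕ) (D : Derivation ℚ (Spoly ℓ) (Spoly ℓ)) : Prop :=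
  ∀ i j : Fin ℓ, i ≠ j → ¬ IsDeleted k i j → (X i - X j) ∣ D (X i) - D (X j)

lemma compat_zero_of_mem_logDer (hℓ : 2 < ℓ) {D : Derivation ℚ (Spoly ℓ) (Spoly ℓ)}
    (hD : D ∈ logDer ℓ ((SimpleGraph.cycleGraph ℓ)ᶜ)) : Compat 0 D := by
  intro i j hij h
  refine hD i j ?_
  rw [SimpleGraph.compl_adj, cycleGraph_adj_iff hℓ]
  refine ⟨hij, fun hc => h ?_⟩
  unfold CycAdj at hc
  unfold IsDeleted
  omega

lemma Compat.succ {k : ℕ} {D : Derivation ℚ (Spoly ℓ) (Spoly ℓ)} {a b : Fin ℓ}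
    (ha : a.val = k) (hb : b.val = k + 1) (hab : (X a - X b) ∣ D (X a) - D (X b))
    (h : ∀ i j : Fin ℓ, i ≠ j → ¬ IsDeleted k i j → ¬ IsDeleted (k + 1) i j →
      (X i - X j) ∣ D (X i) - D (X j)) :
    Compat (k + 1) D := by
  intro i j hij hdel
  by_cases hk : IsDeleted k i j
  · have : (i = a ∧ j = b) ∨ (i = b ∧ j = a) := by
      simp only [Fin.ext_iff]
      unfold IsDeleted at hk hdel
      omega
    rcases this with ⟨rfl, rfl⟩ | ⟨rfl, rfl⟩
    · exact hab
    · rw [← neg_sub (X j), neg_dvd, ← neg_sub (D (X j)), dvd_neg]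
      exact hab
  · exact h i j hij hk hdel

variable [NeZero ℓ]

lemma φder_X_self (b : Fin ℓ) :
    φder ℓ b (X b) = ∏ t ∈ Finset.univ \ {b - 1, b, b + 1}, (X b - X t) := by
  simp [φder]

lemma φder_X_of_ne {b j : Fin ℓ} (h : j ≠ b) : φder ℓ b (X j) = 0 := by
  simp [φder, h]

lemma X_sub_X_dvd_φder (hℓ : 2 < ℓ) {b i j : Fin ℓ} (hij : i ≠ j)
    (h : (i ≠ b ∧ j ≠ b) ∨ ¬ CycAdj i j) :
    (X i - X j : Spoly ℓ) ∣ φder ℓ b (X i) - φder ℓ b (X j) := by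
  by_cases hi : i = b
  · subst hi
    rw [φder_X_of_ne hij.symm, sub_zero, φder_X_self]
    refine Finset.dvd_prod_of_mem (fun t => (X i - X t : Spoly ℓ)) ?_
    rw [mem_sdiff_neighbours_iff hℓ]
    exact ⟨hij.symm, by tauto⟩
  by_cases hj : j = b
  · subst hj
    rw [φder_X_of_ne hij, zero_sub, dvd_neg, φder_X_self, ← neg_sub, neg_dvd]
    refine Finset.dvd_prod_of_mem (fun t => (X j - X t : Spoly ℓ)) ?_
    rw [mem_sdiff_neighbours_iff hℓ]
    refine ⟨hij, ?_⟩
    rcases h with h | h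
    · exact absurd rfl h.2
    · unfold CycAdj at *; omega
  · rw [φder_X_of_ne hi, φder_X_of_ne hj, sub_zero]
    exact dvd_zero _

/-- The first edge of the deleted cycle can be restored by adding multiples of the two `φder` at
its two end points. -/
lemma exists_compat_one (hℓ : 6 ≤ ℓ) {D : Derivation ℚ (Spoly ℓ) (Spoly ℓ)}
    (hD : Compat 0 D) :
    ∃ (a b : Fin ℓ) (u v : Spoly ℓ), Compat 1 (D + u • φder ℓ a + v • φder ℓ b) := by
  obtain ⟨a, ha⟩ : ∃ a : Fin ℓ, a.val = 0 := ⟨⟨0, by omega⟩, rfl⟩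
  obtain ⟨b, hb⟩ : ∃ b : Fin ℓ, b.val = 1 := ⟨⟨1, by omega⟩, rfl⟩
  obtain ⟨c, hc⟩ : ∃ c : Fin ℓ, c.val = 2 := ⟨⟨2, by omega⟩, rfl⟩
  obtain ⟨z, hz⟩ : ∃ z : Fin ℓ, z.val + 1 = ℓ := ⟨⟨ℓ - 1, by omega⟩, by simp; omega⟩
  have hab : a ≠ b := by rw [ne_eq, Fin.ext_iff]; omega
  set T : Finset (Fin ℓ) := Finset.univ \ {z, a, b, c} with hT
  have hTmem : ∀ j, j ∈ T ↔ j.val ≠ 0 ∧ j.val ≠ 1 ∧ j.val ≠ 2 ∧ j.val + 1 ≠ ℓ := by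
    intro j
    simp only [hT, Finset.mem_sdiff, Finset.mem_univ, true_and, Finset.mem_insert,
      Finset.mem_singleton, Fin.ext_iff]
    omega
  have haT : a ∉ T := by rw [hTmem]; omega
  have hbT : b ∉ T := by rw [hTmem]; omega
  have hcT : c ∉ T := by rw [hTmem]; omega
  have hzT : z ∉ T := by rw [hTmem]; omega
  have hdvd : ∀ i j : Fin ℓ, i ≠ j → ¬ CycAdj i j → (X i - X j) ∣ D (X i) - D (X j) := by
    intro i j hij h
    refine hD i j hij ?_
    unfold CycAdj at h
    unfold IsDeleted
    omega
  obtain ⟨q, hq⟩ := exists_dvd_sub_mul_prod (f := fun i => D (X i)) haT hbT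
    (fun j hj => hdvd a j (by rintro rfl; exact haT hj)
      (by rw [hTmem] at hj; unfold CycAdj; omega))
    (fun j hj => hdvd b j (by rintro rfl; exact hbT hj)
      (by rw [hTmem] at hj; unfold CycAdj; omega))
  have hqmem : q ∈ Ideal.span ({X a - X b, X a - X c, X a - X z} : Set (Spoly ℓ)) := by
    have hτ : ∀ i j : Fin ℓ, i ∈ ({a, b, c, z} : Finset (Fin ℓ)) →
        j ∈ ({a, b, c, z} : Finset (Fin ℓ)) → ∀ p : Spoly ℓ, X i - X j ∣ p →
        collapse a {a, b, c, z} p = 0 := by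
      rintro i j hi hj p ⟨r, rfl⟩
      rw [map_mul, map_sub, collapse_X, collapse_X, if_pos hi, if_pos hj, sub_self, zero_mul]
    have h0 := hτ a b (by simp) (by simp) _ hq
    have h1 := hτ a c (by simp) (by simp) _ (hdvd a c (by rw [ne_eq, Fin.ext_iff]; omega)
      (by unfold CycAdj; omega))
    have h2 := hτ c z (by simp) (by simp) _ (hdvd c z (by rw [ne_eq, Fin.ext_iff]; omega)
      (by unfold CycAdj; omega))
    have h3 := hτ z b (by simp) (by simp) _ (hdvd z b (by rw [ne_eq, Fin.ext_iff]; omega)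
      (by unfold CycAdj; omega))
    have hprod : collapse a {a, b, c, z} (∏ j ∈ T, (X a - X j : Spoly ℓ)) =
        ∏ j ∈ T, (X a - X j) := by
      rw [map_prod]
      refine Finset.prod_congr rfl fun j hj => ?_
      rw [map_sub, collapse_X_self, collapse_X, if_neg]
      simp only [Finset.mem_insert, Finset.mem_singleton]
      rintro (rfl | rfl | rfl | rfl) <;> contradiction
    have h4 : collapse a {a, b, c, z} q * ∏ j ∈ T, (X a - X j : Spoly ℓ) = 0 := by
      rw [map_sub, map_sub, map_mul, hprod] at h0
      rw [map_sub] at h1 h2 h3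
      linear_combination h1 + h2 + h3 - h0
    have h5 : collapse a {a, b, c, z} q = 0 := by
      refine (mul_eq_zero.1 h4).resolve_right (Finset.prod_ne_zero_iff.2 fun j hj => ?_)
      exact X_sub_X_ne_zero (by rintro rfl; exact haT hj)
    have h6 := sub_collapse_mem a {a, b, c, z} q
    rw [h5, sub_zero] at h6
    refine Ideal.span_le.2 ?_ h6
    rintro _ ⟨j, hj, rfl⟩
    simp only [Finset.coe_insert, Finset.coe_singleton, Set.mem_insert_iff,
      Set.mem_singleton_iff] at hj
    rcases hj with rfl | rfl | rfl | rfl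
    · simp
    all_goals exact Ideal.subset_span (by simp)
  obtain ⟨w, r, hr, hqr⟩ := Ideal.mem_span_insert.1 hqmem
  obtain ⟨u, v, huv⟩ := Ideal.mem_span_pair.1 hr
  have hφa : φder ℓ a (X a) = (X a - X c) * ∏ j ∈ T, (X a - X j) := by
    rw [φder_X_self, ← Finset.prod_insert (f := fun j => (X a - X j : Spoly ℓ)) hcT]
    refine Finset.prod_congr ?_ fun _ _ => rfl
    ext t
    rw [mem_sdiff_neighbours_iff (by omega), Finset.mem_insert, hTmem, ne_eq, Fin.ext_iff,
      Fin.ext_iff, CycAdj]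
    omega
  have hφb : φder ℓ b (X b) = (X b - X z) * ∏ j ∈ T, (X b - X j) := by
    rw [φder_X_self, ← Finset.prod_insert (f := fun j => (X b - X j : Spoly ℓ)) hzT]
    refine Finset.prod_congr ?_ fun _ _ => rfl
    ext t
    rw [mem_sdiff_neighbours_iff (by omega), Finset.mem_insert, hTmem, ne_eq, Fin.ext_iff,
      Fin.ext_iff, CycAdj]
    omega
  refine ⟨a, b, -u, v, Compat.succ ha (by omega : b.val = 0 + 1) ?_ ?_⟩
  · obtain ⟨s, hs⟩ := hq
    obtain ⟨t, ht⟩ := X_sub_X_dvd_prod_sub_prod (R := ℚ) (a := a) (b := b) T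
    simp only [Derivation.add_apply, Derivation.smul_apply, smul_eq_mul, hφa, hφb,
      φder_X_of_ne hab, φder_X_of_ne hab.symm]
    refine ⟨s + w * ∏ j ∈ T, (X a - X j) + v * (∏ j ∈ T, (X a - X j) + (X b - X z) * t), ?_⟩
    linear_combination hs + (∏ j ∈ T, (X a - X j)) * (hqr - huv) + v * (X b - X z) * ht
  · intro i j hij h0 h1
    have hadj : ¬ CycAdj i j := by
      unfold CycAdj; unfold IsDeleted at h0; omega
    have e : ∀ i : Fin ℓ, (D + -u • φder ℓ a + v • φder ℓ b) (X i) =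
        D (X i) + -u * φder ℓ a (X i) + v * φder ℓ b (X i) := fun i => by simp
    rw [e, e]
    have e2 := dvd_add (dvd_add (hdvd i j hij hadj)
      ((X_sub_X_dvd_φder (by omega) hij (Or.inr hadj) (b := a)).mul_left (-u)))
      ((X_sub_X_dvd_φder (by omega) hij (Or.inr hadj) (b := b)).mul_left v)
    convert e2 using 1
    ring

/-- Each further edge can be restored by adding a multiple of a single `φ`. -/
lemma exists_compat_succ {k : ℕ} (hk : 1 ≤ k) (hkℓ : k + 2 ≤ ℓ)
    {D : Derivation ℚ (Spoly ℓ) (Spoly ℓ)} (hD : Compat k D) :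
    ∃ (b : Fin ℓ) (q : Spoly ℓ), Compat (k + 1) (D + q • φder ℓ b) := by
  obtain ⟨a, ha⟩ : ∃ a : Fin ℓ, a.val = k := ⟨⟨k, by omega⟩, rfl⟩
  obtain ⟨b, hb⟩ : ∃ b : Fin ℓ, b.val = k + 1 := ⟨⟨k + 1, by omega⟩, rfl⟩
  have hab : a ≠ b := by rw [ne_eq, Fin.ext_iff]; omega
  have hmem := mem_sdiff_neighbours_iff (by omega : 2 < ℓ) b
  obtain ⟨q, hq⟩ := exists_dvd_sub_mul_prod (f := fun i => D (X i))
    (T := Finset.univ \ {b - 1, b, b + 1}) (a := b) (b := a)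
    (by rw [hmem]; simp)
    (by rw [hmem]; unfold CycAdj; omega)
    (fun j hj => by
      rw [hmem] at hj
      refine hD b j hj.1.symm ?_
      have := hj.2
      unfold CycAdj at this
      unfold IsDeleted
      omega)
    (fun j hj => by
      rw [hmem, ne_eq, Fin.ext_iff] at hj
      have := hj.2
      unfold CycAdj at this
      refine hD a j (by rw [ne_eq, Fin.ext_iff]; omega) ?_
      unfold IsDeleted
      omega)
  refine ⟨b, -q, Compat.succ ha hb ?_ ?_⟩
  · simp only [Derivation.add_apply, Derivation.smul_apply, smul_eq_mul,
      φder_X_of_ne hab, φder_X_self]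
    rw [← neg_sub (X b), neg_dvd, ← dvd_neg]
    convert hq using 1
    ring
  · intro i j hij h0 h1
    have e : ∀ i : Fin ℓ, (D + -q • φder ℓ b) (X i) =
        D (X i) + -q * φder ℓ b (X i) := fun i => by simp
    have hadj : (i ≠ b ∧ j ≠ b) ∨ ¬ CycAdj i j := by
      simp only [ne_eq, Fin.ext_iff]
      unfold CycAdj
      unfold IsDeleted at h0 h1
      omega
    rw [e, e]
    have e2 := dvd_add (hD i j hij h0)
      ((X_sub_X_dvd_φder (by omega) hij hadj (b := b)).mul_left (-q))
    convert e2 using 1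
    ring

lemma θder_mem {k : ℕ} (hk : k ≤ ℓ - 3) :
    θder ℓ k ∈ Submodule.span (Spoly ℓ)
        ((fun i : ℕ => θder ℓ i) '' {i | i ≤ ℓ - 3} ∪ Set.range (φder ℓ)) :=
  Submodule.subset_span (Or.inl ⟨k, hk, rfl⟩)

lemma φder_mem (b : Fin ℓ) :
    φder ℓ b ∈ Submodule.span (Spoly ℓ)
        ((fun i : ℕ => θder ℓ i) '' {i | i ≤ ℓ - 3} ∪ Set.range (φder ℓ)) :=
  Submodule.subset_span (Or.inr ⟨b, rfl⟩)

/-- When only the edge `{0, ℓ - 1}` is missing, interpolate at the other `ℓ - 2` vertices. -/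
lemma mem_span_of_compat_last (hℓ : 6 ≤ ℓ) {D : Derivation ℚ (Spoly ℓ) (Spoly ℓ)}
    (hD : Compat (ℓ - 1) D) :
    D ∈ Submodule.span (Spoly ℓ)
        ((fun i : ℕ => θder ℓ i) '' {i | i ≤ ℓ - 3} ∪ Set.range (φder ℓ)) := by
  obtain ⟨a, ha⟩ : ∃ a : Fin ℓ, a.val = 0 := ⟨⟨0, by omega⟩, rfl⟩
  obtain ⟨z, hz⟩ : ∃ z : Fin ℓ, z.val + 1 = ℓ := ⟨⟨ℓ - 1, by omega⟩, by simp; omega⟩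
  have haz : a ≠ z := by rw [ne_eq, Fin.ext_iff]; omega
  set T : Finset (Fin ℓ) := Finset.univ \ {a, z} with hT
  have hTmem : ∀ j, j ∈ T ↔ j.val ≠ 0 ∧ j.val + 1 ≠ ℓ := by
    intro j
    simp only [hT, Finset.mem_sdiff, Finset.mem_univ, true_and, Finset.mem_insert,
      Finset.mem_singleton, Fin.ext_iff]
    omega
  have hcard : T.card = ℓ - 2 := by
    rw [hT, Finset.card_sdiff_of_subset (Finset.subset_univ _), Finset.card_univ,
      Fintype.card_fin, Finset.card_pair haz]
  have hdvd : ∀ i j : Fin ℓ, i ≠ j → j ∈ T → (X i - X j) ∣ D (X i) - D (X j) := by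
    intro i j hij hj
    refine hD i j hij ?_
    have := i.isLt
    have := j.isLt
    rw [hTmem] at hj
    unfold IsDeleted
    omega
  obtain ⟨P, hdeg, hP⟩ := exists_interpolation (f := fun i => D (X i)) T
    fun i _ j hj hij => hdvd i j hij hj
  have hφ : ∀ b : Fin ℓ, b ∉ T → φder ℓ b (X b) ∣ D (X b) - P.eval (X b) := by
    intro b hb
    rw [φder_X_self]
    have hmem := mem_sdiff_neighbours_iff (by omega : 2 < ℓ) b
    refine prod_X_sub_X_dvd (by rw [hmem]; simp) fun j hj => ?_
    have hjT : j ∈ T := by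
      rw [hmem, ne_eq, Fin.ext_iff] at hj
      have := hj.2
      unfold CycAdj at this
      rw [hTmem] at hb ⊢
      omega
    have h1 := hdvd b j ((hmem j).1 hj).1.symm hjT
    have h2 := Polynomial.sub_dvd_eval_sub (X b) (X j) P
    rw [hP j hjT] at h2
    simpa using dvd_sub h1 h2
  obtain ⟨u, hu⟩ := hφ a (by rw [hTmem]; omega)
  obtain ⟨v, hv⟩ := hφ z (by rw [hTmem]; omega)
  have hE : D = ∑ k ∈ Finset.range (ℓ - 2), P.coeff k • θder ℓ k + u • φder ℓ a +
      v • φder ℓ z := by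
    refine MvPolynomial.derivation_ext fun i => ?_
    have heval : P.eval (X i) = ∑ k ∈ Finset.range (ℓ - 2), P.coeff k * X i ^ k := by
      refine Polynomial.eval_eq_sum_range' ?_ _
      rw [hcard] at hdeg
      by_cases h0 : P = 0
      · rw [h0, Polynomial.natDegree_zero]
        omega
      · exact (Polynomial.natDegree_lt_iff_degree_lt h0).2 hdeg
    have e : (∑ k ∈ Finset.range (ℓ - 2), P.coeff k • θder ℓ k + u • φder ℓ a +
        v • φder ℓ z) (X i) = P.eval (X i) + u * φder ℓ a (X i) + v * φder ℓ z (X i) := by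
      rw [heval]
      simp [derivation_sum_apply, θder_X]
    rw [e]
    by_cases hia : i = a
    · subst hia
      rw [φder_X_of_ne haz]
      linear_combination hu
    by_cases hiz : i = z
    · subst hiz
      rw [φder_X_of_ne hia]
      linear_combination hv
    · rw [φder_X_of_ne hia, φder_X_of_ne hiz, hP i (by simp [hT, hia, hiz])]
      ring
  rw [hE]
  refine add_mem (add_mem (Submodule.sum_mem _ fun k hk => ?_) ?_) ?_
  · exact Submodule.smul_mem _ _ (θder_mem (by rw [Finset.mem_range] at hk; omega))
  · exact Submodule.smul_mem _ _ (φder_mem _)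
  · exact Submodule.smul_mem _ _ (φder_mem _)

lemma mem_span_of_compat (hℓ : 6 ≤ ℓ) (n : ℕ) {k : ℕ} (hk : 1 ≤ k) (hn : k + n = ℓ - 1)
    {D : Derivation ℚ (Spoly ℓ) (Spoly ℓ)} (hD : Compat k D) :
    D ∈ Submodule.span (Spoly ℓ)
        ((fun i : ℕ => θder ℓ i) '' {i | i ≤ ℓ - 3} ∪ Set.range (φder ℓ)) := by
  induction n generalizing k D with
  | zero =>
    obtain rfl : k = ℓ - 1 := by omega
    exact mem_span_of_compat_last hℓ hD
  | succ n ih =>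
    obtain ⟨b, q, h⟩ := exists_compat_succ hk (by omega) hD
    exact (Submodule.add_mem_iff_left _ (Submodule.smul_mem _ q (φder_mem b))).1
      (ih (by omega) (by omega) h)

end Derivations

/-- The derivation module of the graphic arrangement of the `ℓ`-antihole (the
complement of the `ℓ`-cycle, i.e. the braid arrangement with the hyperplanes
`ker(x_s - x_{s+1})`, indices mod `ℓ`, deleted) is generated by
`θ_0, …, θ_{ℓ-3}, φ_1, …, φ_ℓ`. -/
theorem antihole_generators (ℓ : ℕ) [NeZero ℓ] (hℓ : 6 ≤ ℓ) :
    logDer ℓ ((SimpleGraph.cycleGraph ℓ)ᶜ) =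
      Submodule.span (Spoly ℓ)
        ((fun i : ℕ => θder ℓ i) '' {i | i ≤ ℓ - 3} ∪ Set.range (φder ℓ)) := by
  refine le_antisymm (fun D hD => ?_) (Submodule.span_le.2 ?_)
  · obtain ⟨a, b, u, v, h⟩ := exists_compat_one hℓ (compat_zero_of_mem_logDer (by omega) hD)
    have hmem := mem_span_of_compat hℓ (ℓ - 2) le_rfl (by omega) h
    rw [add_assoc] at hmem
    exact (Submodule.add_mem_iff_left _ (add_mem (Submodule.smul_mem _ u (φder_mem a))
      (Submodule.smul_mem _ v (φder_mem b)))).1 hmem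
  · rintro _ (⟨k, -, rfl⟩ | ⟨b, rfl⟩) i j hij
    · simp only [θder_X]
      exact sub_dvd_pow_sub_pow _ _ _
    · rw [SimpleGraph.compl_adj, cycleGraph_adj_iff (by omega)] at hij
      exact X_sub_X_dvd_φder (by omega) hij.1 (Or.inr hij.2)
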